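/- arXiv:2311.08947 — 4 statements merged into one kernel-verified Lean document; each statement's English description precedes it below -/
import Mathlib

section
/- Let n ≥ 1, λ = (λ_1,…,λ_n) ∈ ℂⁿ with Re λ_i > 0 for all i, and μ ∈ ℂ with Re μ > 0. Let R > 0 and let (c_m)_{m∈ℕⁿ} be complex numbers such that the power series u(x) = Σ_{m∈ℕⁿ} c_m x^m converges absolutely for every x ∈ ℂⁿ with |x_i| < R for all i. Then for every such x the integral (K_x^{μ,λ}u)(x) := (1/Γ(μ)) ∫_{Δ_n} (∏_{i=1}^n t_i^{λ_i−1}) (1−|t|)^{μ−1} u(t_1x_1,…,t_nx_n) dt converges absolutely and equals the absolutely convergent series Σ_{m∈ℕⁿ} [Γ(λ)/Γ(|λ|+μ)] · [(λ)_m / (|λ|+μ)_{|m|}] · c_m x^m. -/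
open MeasureTheory Complex

noncomputable section

/-- The open simplex `{t ∈ ℝⁿ : tᵢ > 0, t₁ + ⋯ + tₙ < 1}`. -/
def openSimplex (n : ℕ) : Set (Fin n → ℝ) := {t | (∀ i, 0 < t i) ∧ ∑ i, t i < 1}

/-- The Pochhammer symbol `(a)ₖ = a(a+1)⋯(a+k-1)`. -/
def poch (a : ℂ) (k : ℕ) : ℂ := ∏ i ∈ Finset.range k, (a + i)

theorem poch_mul_Gamma {a : ℂ} (ha : 0 < a.re) (k : ℕ) :
    poch a k * Gamma a = Gamma (a + k) := by
  induction k with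
  | zero => simp [poch]
  | succ k ih =>
    have hne : a + k ≠ 0 := fun h => by
      have h1 : (a + k).re = a.re + k := by simp
      rw [h, zero_re] at h1
      have h2 : (0 : ℝ) ≤ k := k.cast_nonneg
      linarith
    have hsucc : poch a (k + 1) = poch a k * (a + k) := Finset.prod_range_succ _ _
    rw [hsucc, mul_right_comm, ih, Nat.cast_succ, ← add_assoc, Gamma_add_one _ hne, mul_comm]

theorem measurableSet_openSimplex (n : ℕ) : MeasurableSet (openSimplex n) := by
  have h : IsOpen (openSimplex n) := by
    have : openSimplex n = (⋂ i, {t : Fin n → ℝ | 0 < t i}) ∩ {t | ∑ i, t i < 1} := by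
      ext t; simp [openSimplex]
    rw [this]
    exact (isOpen_iInter_of_finite fun i => isOpen_lt continuous_const (continuous_apply i)).inter
      (isOpen_lt (by fun_prop) continuous_const)
  exact h.measurableSet

theorem lt_one_of_mem_openSimplex {n : ℕ} {t : Fin n → ℝ} (ht : t ∈ openSimplex n) (i : Fin n) :
    t i < 1 :=
  (Finset.single_le_sum (fun j _ => (ht.1 j).le) (Finset.mem_univ i)).trans_lt ht.2

/-- The density of the Dirichlet integral, extended by zero outside of the open simplex. -/
def dirichletDensity {n : ℕ} (lam : Fin n → ℂ) (μ : ℂ) : (Fin n → ℝ) → ℂ :=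
  (openSimplex n).indicator fun t =>
    (∏ i, (t i : ℂ) ^ (lam i - 1)) * ((1 - ∑ i, t i : ℝ) : ℂ) ^ (μ - 1)

theorem measurable_dirichletDensity {n : ℕ} (lam : Fin n → ℂ) (μ : ℂ) :
    Measurable (dirichletDensity lam μ) := by
  refine Measurable.indicator ?_ (measurableSet_openSimplex n)
  fun_prop

theorem cons_mem_openSimplex {n : ℕ} (x : ℝ) (s : Fin n → ℝ) :
    (Fin.cons x s : Fin (n + 1) → ℝ) ∈ openSimplex (n + 1) ↔
      s ∈ openSimplex n ∧ x ∈ Set.Ioo 0 (1 - ∑ i, s i) := by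
  simp only [openSimplex, Set.mem_ofPred_eq, Fin.forall_fin_succ, Fin.cons_zero, Fin.cons_succ,
    Fin.sum_univ_succ, Set.mem_Ioo]
  constructor
  · rintro ⟨⟨h0, hs⟩, h⟩
    exact ⟨⟨hs, by linarith⟩, h0, by linarith⟩
  · rintro ⟨⟨hs, h⟩, h0, h1⟩
    exact ⟨⟨h0, hs⟩, by linarith⟩

theorem dirichletDensity_cons {n : ℕ} (lam : Fin (n + 1) → ℂ) (μ : ℂ) {s : Fin n → ℝ}
    (hs : s ∈ openSimplex n) (x : ℝ) :
    dirichletDensity lam μ (Fin.cons x s) =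
      (∏ i, (s i : ℂ) ^ (lam i.succ - 1)) * (Set.Ioo 0 (1 - ∑ i, s i)).indicator
        (fun x : ℝ => (x : ℂ) ^ (lam 0 - 1) *
          (((1 - ∑ i, s i : ℝ) : ℂ) - x) ^ (μ - 1)) x := by
  unfold dirichletDensity
  by_cases hx : x ∈ Set.Ioo 0 (1 - ∑ i, s i)
  · rw [Set.indicator_of_mem ((cons_mem_openSimplex x s).2 ⟨hs, hx⟩), Set.indicator_of_mem hx]
    simp only [Fin.prod_univ_succ, Fin.sum_univ_succ, Fin.cons_zero, Fin.cons_succ]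
    rw [← ofReal_sub, show 1 - (x + ∑ i, s i) = 1 - ∑ i, s i - x by ring]
    ring
  · rw [Set.indicator_of_notMem (fun h => hx ((cons_mem_openSimplex x s).1 h).2),
      Set.indicator_of_notMem hx, mul_zero]

theorem dirichletDensity_cons_of_notMem {n : ℕ} (lam : Fin (n + 1) → ℂ) (μ : ℂ) {s : Fin n → ℝ}
    (hs : s ∉ openSimplex n) (x : ℝ) :
    dirichletDensity lam μ (Fin.cons x s) = 0 :=
  Set.indicator_of_notMem (fun h => hs ((cons_mem_openSimplex x s).1 h).1) _

theorem norm_dirichletDensity {n : ℕ} (lam : Fin n → ℂ) (μ : ℂ) (t : Fin n → ℝ) :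
    ((‖dirichletDensity lam μ t‖ : ℝ) : ℂ) =
      dirichletDensity (fun i => ((lam i).re : ℂ)) (μ.re : ℂ) t := by
  unfold dirichletDensity
  by_cases ht : t ∈ openSimplex n
  · rw [Set.indicator_of_mem ht, Set.indicator_of_mem ht, norm_mul, norm_prod, ofReal_mul,
      ofReal_prod]
    have key : ∀ {x : ℝ} (_ : 0 < x) (z : ℂ),
        ((‖(x : ℂ) ^ (z - 1)‖ : ℝ) : ℂ) = (x : ℂ) ^ ((z.re : ℂ) - 1) := fun hx z => by
      rw [norm_cpow_eq_rpow_re_of_pos hx, ofReal_cpow hx.le]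
      simp
    rw [key (sub_pos.2 ht.2), Finset.prod_congr rfl fun i _ => key (ht.1 i) (lam i)]
  · simp [ht]

theorem integral_Ioo_beta (u v : ℂ) {a : ℝ} (ha : 0 < a) :
    ∫ x, (Set.Ioo 0 a).indicator
        (fun x : ℝ => (x : ℂ) ^ (u - 1) * ((a : ℂ) - x) ^ (v - 1)) x =
      (a : ℂ) ^ (u + v - 1) * betaIntegral u v := by
  rw [integral_indicator measurableSet_Ioo, ← integral_Ioc_eq_integral_Ioo,
    ← intervalIntegral.integral_of_le ha.le, betaIntegral_scaled u v ha]

theorem integrable_Ioo_beta {u v : ℂ} (hu : 0 < u.re) (hv : 0 < v.re) {a : ℝ} (ha : 0 < a) :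
    Integrable ((Set.Ioo 0 a).indicator
        (fun x : ℝ => (x : ℂ) ^ (u - 1) * ((a : ℂ) - x) ^ (v - 1))) := by
  by_contra h
  have h0 := integral_Ioo_beta u v ha
  rw [integral_undef h, betaIntegral_eq_Gamma_mul_div u v hu hv] at h0
  refine mul_ne_zero ?_ (div_ne_zero (mul_ne_zero (Gamma_ne_zero_of_re_pos hu)
    (Gamma_ne_zero_of_re_pos hv)) (Gamma_ne_zero_of_re_pos (by simpa using add_pos hu hv))) h0.symm
  simp [cpow_eq_zero_iff, ha.ne']


theorem integral_dirichletDensity_cons {n : ℕ} (lam : Fin (n + 1) → ℂ) (μ : ℂ) (s : Fin n → ℝ) :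
    ∫ x, dirichletDensity lam μ (Fin.cons x s) =
      dirichletDensity (fun i => lam i.succ) (lam 0 + μ) s * betaIntegral (lam 0) μ := by
  by_cases hs : s ∈ openSimplex n
  · simp_rw [dirichletDensity_cons lam μ hs]
    rw [integral_const_mul, integral_Ioo_beta _ _ (sub_pos.2 hs.2), dirichletDensity,
      Set.indicator_of_mem hs, mul_assoc]
  · simp_rw [dirichletDensity_cons_of_notMem lam μ hs]
    simp [dirichletDensity, hs]

/-- The Dirichlet integral over the simplex converges and is a quotient of Gamma values. -/
theorem dirichletDensity_integral {n : ℕ} (lam : Fin n → ℂ) (hlam : ∀ i, 0 < (lam i).re)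
    (μ : ℂ) (hμ : 0 < μ.re) :
    Integrable (dirichletDensity lam μ) ∧
      ∫ t, dirichletDensity lam μ t =
        (∏ i, Gamma (lam i)) * Gamma μ / Gamma ((∑ i, lam i) + μ) := by
  induction n generalizing μ with
  | zero =>
    have h : dirichletDensity lam μ = fun _ => 1 := by
      funext t
      simp [dirichletDensity, openSimplex]
    rw [h]
    refine ⟨?_, ?_⟩
    · have : IsFiniteMeasure (volume : Measure (Fin 0 → ℝ)) := ⟨by simp [volume_pi]⟩
      exact integrable_const _
    · simp [Measure.real, volume_pi, div_self (Gamma_ne_zero_of_re_pos hμ)]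
  | succ n ih =>
    have hre : 0 < (lam 0 + μ).re := by simpa using add_pos (hlam 0) hμ
    obtain ⟨ihi, ihv⟩ := ih (fun i => lam i.succ) (fun i => hlam i.succ) (lam 0 + μ) hre
    have mp := (volume_preserving_piFinSuccAbove (fun _ : Fin (n + 1) => ℝ) 0).symm
    have he : ∀ p : ℝ × (Fin n → ℝ),
        (MeasurableEquiv.piFinSuccAbove (fun _ : Fin (n + 1) => ℝ) 0).symm p =
          (Fin.cons p.1 p.2 : Fin (n + 1) → ℝ) := fun p => by
      simp [MeasurableEquiv.piFinSuccAbove, Fin.insertNthEquiv]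
    have hint : Integrable (fun p : ℝ × (Fin n → ℝ) =>
        dirichletDensity lam μ (Fin.cons p.1 p.2)) (volume.prod volume) := by
      have hmeas : Measurable (fun p : ℝ × (Fin n → ℝ) =>
          dirichletDensity lam μ (Fin.cons p.1 p.2)) := by
        simp_rw [← he]
        exact (measurable_dirichletDensity lam μ).comp (MeasurableEquiv.measurable _)
      rw [integrable_prod_iff' hmeas.aestronglyMeasurable]
      refine ⟨.of_forall fun s => ?_, ?_⟩
      · by_cases hs : s ∈ openSimplex n
        · simp_rw [dirichletDensity_cons lam μ hs]
          exact (integrable_Ioo_beta (hlam 0) hμ (sub_pos.2 hs.2)).const_mul _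
        · simp_rw [dirichletDensity_cons_of_notMem lam μ hs]
          exact integrable_zero _ _ _
      · refine (ihi.norm.mul_const ‖betaIntegral ((lam 0).re : ℂ) (μ.re : ℂ)‖).congr
          (.of_forall fun s => ?_)
        have h := integral_dirichletDensity_cons (fun i => ((lam i).re : ℂ)) (μ.re : ℂ) s
        simp_rw [← norm_dirichletDensity] at h
        rw [← ofReal_add, ← add_re, ← norm_dirichletDensity, integral_complex_ofReal] at h
        have h' := congrArg norm h
        rw [norm_mul, norm_real, norm_real, norm_norm, Real.norm_of_nonneg
          (integral_nonneg fun _ => norm_nonneg _)] at h'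
        exact h'.symm
    have hcomp := mp.integrable_comp_emb (MeasurableEquiv.measurableEmbedding _)
      (g := dirichletDensity lam μ)
    refine ⟨hcomp.1 (hint.congr (.of_forall fun p => congrArg _ (he p).symm)), ?_⟩
    rw [← mp.integral_comp (MeasurableEquiv.measurableEmbedding _)]
    simp_rw [he]
    rw [show (volume : Measure (ℝ × (Fin n → ℝ))) = volume.prod volume from rfl,
      integral_prod_symm _ hint]
    simp_rw [integral_dirichletDensity_cons]
    rw [integral_mul_const, ihv, betaIntegral_eq_Gamma_mul_div _ _ (hlam 0) hμ,
      Fin.prod_univ_succ, Fin.sum_univ_succ,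
      show ∑ i : Fin n, lam i.succ + (lam 0 + μ) = lam 0 + ∑ i : Fin n, lam i.succ + μ by ring]
    have := Gamma_ne_zero_of_re_pos hre
    field_simp

theorem dirichletDensity_mul_monomial {n : ℕ} (lam : Fin n → ℂ) (μ : ℂ) (x : Fin n → ℂ)
    (m : Fin n → ℕ) (t : Fin n → ℝ) :
    dirichletDensity lam μ t * ∏ i, ((t i : ℂ) * x i) ^ m i =
      dirichletDensity (fun i => lam i + m i) μ t * ∏ i, x i ^ m i := by
  unfold dirichletDensity
  by_cases ht : t ∈ openSimplex n
  · have h : ∀ i, (t i : ℂ) ^ (lam i + m i - 1) = (t i : ℂ) ^ (lam i - 1) * (t i : ℂ) ^ m i :=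
      fun i => by
        rw [add_sub_right_comm, cpow_add _ _ (ofReal_ne_zero.2 (ht.1 i).ne'), cpow_natCast]
    simp only [Set.indicator_of_mem ht, h, mul_pow, Finset.prod_mul_distrib]
    ring
  · simp [ht]

theorem integral_dirichletDensity_add_nat {n : ℕ} (lam : Fin n → ℂ) (hlam : ∀ i, 0 < (lam i).re)
    (μ : ℂ) (hμ : 0 < μ.re) (m : Fin n → ℕ) :
    1 / Gamma μ * ∫ t, dirichletDensity (fun i => lam i + m i) μ t =
      (∏ i, Gamma (lam i)) / Gamma ((∑ i, lam i) + μ) *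
        ((∏ i, poch (lam i) (m i)) / poch ((∑ i, lam i) + μ) (∑ i, m i)) := by
  have hsum : 0 < ((∑ i, lam i) + μ).re := by
    rw [add_re, re_sum]
    exact add_pos_of_nonneg_of_pos (Finset.sum_nonneg fun i _ => (hlam i).le) hμ
  rw [(dirichletDensity_integral (fun i => lam i + m i) (fun i => by
    simpa using add_pos_of_pos_of_nonneg (hlam i) (m i).cast_nonneg) μ hμ).2,
    Finset.prod_congr rfl fun i _ => (poch_mul_Gamma (hlam i) (m i)).symm,
    Finset.prod_mul_distrib, Finset.sum_add_distrib, add_right_comm, ← Nat.cast_sum,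
    ← poch_mul_Gamma hsum]
  have := Gamma_ne_zero_of_re_pos hμ
  field_simp

theorem stmt1 (n : ℕ) (hn : 1 ≤ n) (lam : Fin n → ℂ) (hlam : ∀ i, 0 < (lam i).re)
    (μ : ℂ) (hμ : 0 < μ.re) (R : ℝ) (hR : 0 < R) (c : (Fin n → ℕ) → ℂ)
    (hconv : ∀ x : Fin n → ℂ, (∀ i, ‖x i‖ < R) →
      Summable (fun m : Fin n → ℕ => ‖c m‖ * ∏ i, ‖x i‖ ^ m i))
    (x : Fin n → ℂ) (hx : ∀ i, ‖x i‖ < R) :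
    IntegrableOn
      (fun t : Fin n → ℝ =>
        (∏ i, (t i : ℂ) ^ (lam i - 1)) * ((1 - ∑ i, t i : ℝ) : ℂ) ^ (μ - 1) *
          ∑' m : Fin n → ℕ, c m * ∏ i, ((t i : ℂ) * x i) ^ m i)
      (openSimplex n) ∧
    Summable (fun m : Fin n → ℕ =>
      ‖(∏ i, Complex.Gamma (lam i)) / Complex.Gamma ((∑ i, lam i) + μ) *
          ((∏ i, poch (lam i) (m i)) / poch ((∑ i, lam i) + μ) (∑ i, m i)) *
          c m * ∏ i, x i ^ m i‖) ∧
    (1 / Complex.Gamma μ) *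
        ∫ t in openSimplex n,
          (∏ i, (t i : ℂ) ^ (lam i - 1)) * ((1 - ∑ i, t i : ℝ) : ℂ) ^ (μ - 1) *
            ∑' m : Fin n → ℕ, c m * ∏ i, ((t i : ℂ) * x i) ^ m i
      = ∑' m : Fin n → ℕ,
          (∏ i, Complex.Gamma (lam i)) / Complex.Gamma ((∑ i, lam i) + μ) *
            ((∏ i, poch (lam i) (m i)) / poch ((∑ i, lam i) + μ) (∑ i, m i)) *
            c m * ∏ i, x i ^ m i := by
  set D := dirichletDensity lam μ with hD
  have hDint : Integrable D := (dirichletDensity_integral lam hlam μ hμ).1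
  have hS := hconv x hx
  have hbound : ∀ m : Fin n → ℕ, ∀ t ∈ openSimplex n,
      ‖c m * ∏ i, ((t i : ℂ) * x i) ^ m i‖ ≤ ‖c m‖ * ∏ i, ‖x i‖ ^ m i := fun m t ht => by
    rw [norm_mul, norm_prod]
    gcongr with i
    rw [norm_pow, norm_mul, norm_real, Real.norm_of_nonneg (ht.1 i).le]
    exact pow_le_pow_left₀ (mul_nonneg (ht.1 i).le (norm_nonneg _))
      (mul_le_of_le_one_left (norm_nonneg _) (lt_one_of_mem_openSimplex ht i).le) _
  have hF : ∀ (m : Fin n → ℕ) (t : Fin n → ℝ), D t * (c m * ∏ i, ((t i : ℂ) * x i) ^ m i) =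
      c m * (∏ i, x i ^ m i) * dirichletDensity (fun i => lam i + m i) μ t := fun m t => by
    rw [mul_left_comm, hD, dirichletDensity_mul_monomial]
    ring
  have hFint : ∀ m : Fin n → ℕ,
      Integrable fun t : Fin n → ℝ => D t * (c m * ∏ i, ((t i : ℂ) * x i) ^ m i) := fun m => by
    simp_rw [hF]
    exact (dirichletDensity_integral (fun i => lam i + m i) (fun i => by
      simpa using add_pos_of_pos_of_nonneg (hlam i) (m i).cast_nonneg) μ hμ).1.const_mul _
  have hFnorm : ∀ (m : Fin n → ℕ), ∫ t, ‖D t * (c m * ∏ i, ((t i : ℂ) * x i) ^ m i)‖ ≤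
      (‖c m‖ * ∏ i, ‖x i‖ ^ m i) * ∫ t, ‖D t‖ := fun m => by
    rw [← integral_const_mul]
    refine integral_mono (hFint m).norm (hDint.norm.const_mul _) fun t => ?_
    by_cases ht : t ∈ openSimplex n
    · simp only [norm_mul (D t)]
      rw [mul_comm]
      gcongr
      exact hbound m t ht
    · simp [hD, dirichletDensity, ht]
  have hsum : Summable fun m : Fin n → ℕ =>
      ∫ t, ‖D t * (c m * ∏ i, ((t i : ℂ) * x i) ^ m i)‖ :=
    .of_nonneg_of_le (fun m => integral_nonneg fun t => norm_nonneg _) hFnorm (hS.mul_right _)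
  have hval : ∀ m : Fin n → ℕ,
      1 / Gamma μ * ∫ t, D t * (c m * ∏ i, ((t i : ℂ) * x i) ^ m i) =
        (∏ i, Gamma (lam i)) / Gamma ((∑ i, lam i) + μ) *
          ((∏ i, poch (lam i) (m i)) / poch ((∑ i, lam i) + μ) (∑ i, m i)) *
          c m * ∏ i, x i ^ m i := fun m => by
    simp_rw [hF]
    rw [integral_const_mul, mul_left_comm, integral_dirichletDensity_add_nat lam hlam μ hμ]
    ring
  have hDeq : ∀ t ∈ openSimplex n, D t =
      (∏ i, (t i : ℂ) ^ (lam i - 1)) * ((1 - ∑ i, t i : ℝ) : ℂ) ^ (μ - 1) := fun t ht =>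
    Set.indicator_of_mem ht _
  have hms := measurableSet_openSimplex n
  refine ⟨?_, ?_, ?_⟩
  · have hint : IntegrableOn (fun t : Fin n → ℝ =>
        D t * ∑' m : Fin n → ℕ, c m * ∏ i, ((t i : ℂ) * x i) ^ m i) (openSimplex n) := by
      refine hDint.integrableOn.mul_bdd (c := ∑' m : Fin n → ℕ, ‖c m‖ * ∏ i, ‖x i‖ ^ m i) ?_ ?_
      · refine ContinuousOn.aestronglyMeasurable ?_ hms
        exact continuousOn_tsum (fun m => by fun_prop) hS hbound
      · exact (ae_restrict_iff' hms).2 (.of_forall fun t ht =>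
          tsum_of_norm_bounded hS.hasSum fun m => hbound m t ht)
    exact hint.congr_fun (fun t ht => by simp only [hDeq t ht]) hms
  · simp_rw [← hval, norm_mul (1 / Gamma μ)]
    exact (Summable.of_nonneg_of_le (fun m => norm_nonneg _)
      (fun m => norm_integral_le_integral_norm _) hsum).mul_left _
  · have hset : ∫ t in openSimplex n,
          (∏ i, (t i : ℂ) ^ (lam i - 1)) * ((1 - ∑ i, t i : ℝ) : ℂ) ^ (μ - 1) *
            ∑' m : Fin n → ℕ, c m * ∏ i, ((t i : ℂ) * x i) ^ m i =
        ∫ t, ∑' m : Fin n → ℕ, D t * (c m * ∏ i, ((t i : ℂ) * x i) ^ m i) := by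
      rw [← integral_indicator hms]
      refine integral_congr_ae (.of_forall fun t => ?_)
      simp only [tsum_mul_left]
      by_cases ht : t ∈ openSimplex n
      · rw [Set.indicator_of_mem ht, hDeq t ht]
      · simp [hD, dirichletDensity, ht]
    simp_rw [← hval]
    rw [hset, tsum_mul_left, (hasSum_integral_of_summable_integral_norm hFint hsum).tsum_eq]
end
end

section
/- Let s ∈ ℂ with 0 ≤ Re s < 1, let c ∈ ℝ with 0 < c < 1 − Re s, and let α, τ ∈ ℂ with 0 < Re τ < 1 and Re(α + τ) > 0. Then the integral over the vertical line Re t = c satisfies ∫_{−∞}^{∞} (c+iy)^{−α−1} · (1 − s − (c+iy))^{−τ} dy = 2π · [Γ(α+τ) / (Γ(τ)Γ(α+1))] · (1−s)^{−α−τ}, the integral being absolutely convergent; here all complex powers are principal branches (note that Re(c+iy) = c > 0, Re(1−s−(c+iy)) = 1 − Re s − c > 0 and Re(1−s) > 0, so all bases lie off (−∞,0]). -/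
open MeasureTheory Complex

noncomputable section

section CauchyBeta

open Filter Set Topology

theorem norm_cpow_mul_exp_neg_mul {a z : ℂ} {x : ℝ} (hx : 0 < x) :
    ‖(x : ℂ) ^ (a - 1) * exp (-(z * x))‖ = x ^ (a.re - 1) * Real.exp (-z.re * x ^ (1 : ℝ)) := by
  rw [norm_mul, norm_cpow_eq_rpow_re_of_pos hx, norm_exp]
  simp

theorem aestronglyMeasurable_cpow_mul_exp_neg_mul (a z : ℂ) :
    AEStronglyMeasurable (fun x : ℝ => (x : ℂ) ^ (a - 1) * exp (-(z * x)))
      (volume.restrict (Ioi 0)) := by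
  refine ContinuousOn.aestronglyMeasurable (fun x hx => ?_) measurableSet_Ioi
  refine ContinuousAt.continuousWithinAt (ContinuousAt.mul ?_ (by fun_prop))
  exact continuousAt_ofReal_cpow_const _ _ (Or.inr (ne_of_gt hx))

theorem integrableOn_cpow_mul_exp_neg_mul {a z : ℂ} (ha : 0 < a.re) (hz : 0 < z.re) :
    IntegrableOn (fun x : ℝ => (x : ℂ) ^ (a - 1) * exp (-(z * x))) (Ioi 0) := by
  refine Integrable.mono' (integrableOn_rpow_mul_exp_neg_mul_rpow (p := 1) (s := a.re - 1)
    (b := z.re) (by linarith) one_pos hz) (aestronglyMeasurable_cpow_mul_exp_neg_mul a z) ?_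
  filter_upwards [ae_restrict_mem measurableSet_Ioi] with x hx
  exact (norm_cpow_mul_exp_neg_mul hx).le

theorem hasDerivAt_integral_cpow_mul_exp_neg_mul {a z : ℂ} (ha : 0 < a.re) (hz : 0 < z.re) :
    HasDerivAt (fun z : ℂ => ∫ x : ℝ in Ioi 0, (x : ℂ) ^ (a - 1) * exp (-(z * x)))
      (∫ x : ℝ in Ioi 0, -((x : ℂ) ^ (a + 1 - 1) * exp (-(z * x)))) z := by
  have hs : {v : ℂ | z.re / 2 < v.re} ∈ 𝓝 z :=
    (isOpen_lt continuous_const continuous_re).mem_nhds (by simpa using hz)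
  refine (hasDerivAt_integral_of_dominated_loc_of_deriv_le hs
    (bound := fun x : ℝ => x ^ a.re * Real.exp (-(z.re / 2) * x ^ (1 : ℝ)))
    (Eventually.of_forall fun v => aestronglyMeasurable_cpow_mul_exp_neg_mul a v)
    (integrableOn_cpow_mul_exp_neg_mul ha hz)
    (F' := fun v x => -((x : ℂ) ^ (a + 1 - 1) * exp (-(v * x))))
    (aestronglyMeasurable_cpow_mul_exp_neg_mul (a + 1) z).neg ?_
    (integrableOn_rpow_mul_exp_neg_mul_rpow (by linarith) one_pos (by linarith)) ?_).2
  · filter_upwards [ae_restrict_mem measurableSet_Ioi] with x hx v hv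
    have hx' : (0 : ℝ) < x := hx
    have hv' : z.re / 2 < v.re := hv
    rw [norm_neg, norm_cpow_mul_exp_neg_mul hx]
    simp only [add_re, one_re, add_sub_cancel_right, Real.rpow_one]
    gcongr
  · filter_upwards [ae_restrict_mem measurableSet_Ioi] with x hx v _
    have hx' : (x : ℂ) ≠ 0 := ofReal_ne_zero.mpr (ne_of_gt hx)
    have h1 : HasDerivAt (fun v : ℂ => exp (-(v * x))) (exp (-(v * x)) * -(1 * x)) v :=
      ((hasDerivAt_id v).mul_const (x : ℂ)).neg.cexp
    refine (h1.const_mul ((x : ℂ) ^ (a - 1))).congr_deriv ?_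
    have : (x : ℂ) ^ (a + 1 - 1) = (x : ℂ) ^ (a - 1) * x := by
      rw [show a + 1 - 1 = (a - 1) + 1 by ring, cpow_add _ _ hx', cpow_one]
    rw [this]; ring

theorem integral_cpow_mul_exp_neg_mul_Ioi_of_re_pos {a z : ℂ} (ha : 0 < a.re) (hz : 0 < z.re) :
    ∫ x : ℝ in Ioi 0, (x : ℂ) ^ (a - 1) * exp (-(z * x)) = z ^ (-a) * Gamma a := by
  have hU : IsOpen {z : ℂ | 0 < z.re} := isOpen_lt continuous_const continuous_re
  have h1 : AnalyticOnNhd ℂ (fun z : ℂ => ∫ x : ℝ in Ioi 0, (x : ℂ) ^ (a - 1) * exp (-(z * x)))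
      {z : ℂ | 0 < z.re} :=
    DifferentiableOn.analyticOnNhd (fun v hv =>
      (hasDerivAt_integral_cpow_mul_exp_neg_mul ha hv).differentiableAt.differentiableWithinAt) hU
  have h2 : AnalyticOnNhd ℂ (fun z : ℂ => z ^ (-a) * Gamma a) {z : ℂ | 0 < z.re} :=
    DifferentiableOn.analyticOnNhd (fun v hv =>
      (((hasDerivAt_id v).cpow_const (c := -a) (Or.inl hv)).mul_const
        _).differentiableAt.differentiableWithinAt) hU
  refine h1.eqOn_of_preconnected_of_frequently_eq h2
    (convex_halfSpace_re_gt 0).isPreconnected (z₀ := 1) (by simp) ?_ hz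
  have htend : Tendsto (fun r : ℝ => (r : ℂ)) (𝓝[>] 1) (𝓝[≠] 1) := by
    refine tendsto_nhdsWithin_iff.mpr ⟨?_, ?_⟩
    · exact (continuous_ofReal.tendsto' 1 1 (by simp)).mono_left nhdsWithin_le_nhds
    · filter_upwards [self_mem_nhdsWithin] with r hr
      simpa using ne_of_gt hr
  refine htend.frequently (Eventually.frequently ?_)
  filter_upwards [self_mem_nhdsWithin] with r hr
  have hr0 : (0 : ℝ) < r := one_pos.trans hr
  rw [integral_cpow_mul_exp_neg_mul_Ioi ha hr0, one_div, inv_cpow, cpow_neg]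
  rw [arg_ofReal_of_nonneg hr0.le]
  exact Real.pi_pos.ne

/-- Complex powers along a vertical line in the right half-plane grow at most like powers of `1 + |y|`. -/
theorem exists_norm_cpow_add_mul_I_le {d : ℂ} (hd : 0 < d.re) (p : ℂ) :
    ∃ C : ℝ, 0 ≤ C ∧ ∀ y : ℝ, ‖(d + y * I) ^ p‖ ≤ C * (1 + |y|) ^ p.re := by
  have hpos : ∀ y : ℝ, 0 < (d + y * I).re := fun y => by simpa using hd
  have hne : ∀ y : ℝ, d + y * I ≠ 0 := fun y h => by
    have := hpos y
    rw [h] at this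
    simp at this
  have hup : ∀ y : ℝ, ‖d + y * I‖ ≤ (1 + ‖d‖) * (1 + |y|) := fun y => by
    have h1 : ‖d + y * I‖ ≤ ‖d‖ + |y| := by simpa using norm_add_le d (y * I)
    nlinarith [norm_nonneg d, abs_nonneg y]
  set k : ℝ := d.re / (1 + d.re + ‖d‖) with hk
  have hden : 0 < 1 + d.re + ‖d‖ := by positivity
  have hk0 : 0 < k := by positivity
  have hlow : ∀ y : ℝ, k * (1 + |y|) ≤ ‖d + y * I‖ := fun y => by
    have h1 : d.re ≤ ‖d + y * I‖ := by simpa using re_le_norm (d + y * I)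
    have h2 : |y| ≤ ‖d + y * I‖ + ‖d‖ := by
      have := norm_sub_le (d + y * I) d
      simpa using this
    rw [hk, div_mul_eq_mul_div, div_le_iff₀ hden]
    nlinarith [norm_nonneg d]
  have hE : ∀ y : ℝ, ‖(d + y * I) ^ p‖ ≤
      ‖d + y * I‖ ^ p.re * Real.exp (Real.pi * |p.im|) := fun y => by
    refine (norm_cpow_le _ _).trans ?_
    rw [div_eq_mul_inv, ← Real.exp_neg]
    gcongr
    calc -((d + y * I).arg * p.im) ≤ |(d + y * I).arg * p.im| := neg_le_abs _
      _ = |(d + y * I).arg| * |p.im| := abs_mul _ _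
      _ ≤ _ := by gcongr; exact abs_arg_le_pi _
  have hy : ∀ y : ℝ, 0 < 1 + |y| := fun y => by positivity
  rcases le_total 0 p.re with hp | hp
  · refine ⟨(1 + ‖d‖) ^ p.re * Real.exp (Real.pi * |p.im|), by positivity, fun y => ?_⟩
    refine (hE y).trans ?_
    have := Real.rpow_le_rpow (norm_nonneg _) (hup y) hp
    rw [Real.mul_rpow (by positivity) (hy y).le] at this
    calc _ ≤ (1 + ‖d‖) ^ p.re * (1 + |y|) ^ p.re * Real.exp (Real.pi * |p.im|) := by gcongr
      _ = _ := by ring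
  · refine ⟨k ^ p.re * Real.exp (Real.pi * |p.im|), by positivity, fun y => ?_⟩
    refine (hE y).trans ?_
    have := Real.rpow_le_rpow_of_nonpos (mul_pos hk0 (hy y)) (hlow y) hp
    rw [Real.mul_rpow hk0.le (hy y).le] at this
    calc _ ≤ k ^ p.re * (1 + |y|) ^ p.re * Real.exp (Real.pi * |p.im|) := by gcongr
      _ = _ := by ring

theorem exists_norm_cpow_mul_cpow_le {d e : ℂ} (hd : 0 < d.re) (he : 0 < e.re) (p q : ℂ) :
    ∃ C : ℝ, ∀ y : ℝ, ‖(d + y * I) ^ p * (e - y * I) ^ q‖ ≤ C * (1 + |y|) ^ (p + q).re := by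
  obtain ⟨C, hC, h1⟩ := exists_norm_cpow_add_mul_I_le hd p
  obtain ⟨D, hD, h2⟩ := exists_norm_cpow_add_mul_I_le he q
  refine ⟨C * D, fun y => ?_⟩
  have h3 := h2 (-y)
  rw [abs_neg, ofReal_neg, neg_mul, ← sub_eq_add_neg] at h3
  rw [norm_mul, add_re, Real.rpow_add (by positivity)]
  calc _ ≤ (C * (1 + |y|) ^ p.re) * (D * (1 + |y|) ^ q.re) := by
        gcongr
        exact h1 y
      _ = _ := by ring

theorem add_mul_I_mem_slitPlane {d : ℂ} (hd : 0 < d.re) (y : ℝ) : d + y * I ∈ slitPlane :=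
  Or.inl (by simpa using hd)

theorem sub_mul_I_mem_slitPlane {d : ℂ} (hd : 0 < d.re) (y : ℝ) : d - y * I ∈ slitPlane :=
  Or.inl (by simpa using hd)

theorem continuous_add_mul_I_cpow {d : ℂ} (hd : 0 < d.re) (p : ℂ) :
    Continuous fun y : ℝ => (d + y * I) ^ p :=
  Continuous.cpow (by fun_prop) continuous_const (add_mul_I_mem_slitPlane hd)

theorem integrable_cpow_mul_cpow {d e : ℂ} (hd : 0 < d.re) (he : 0 < e.re) {p q : ℂ}
    (hpq : (p + q).re < -1) :
    Integrable fun y : ℝ => (d + y * I) ^ p * (e - y * I) ^ q := by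
  obtain ⟨C, hC⟩ := exists_norm_cpow_mul_cpow_le hd he p q
  have h := (integrable_one_add_norm (E := ℝ) (μ := volume) (r := -(p + q).re)
    (by simp only [Module.finrank_self, Nat.cast_one]; linarith)).const_mul C
  refine h.mono' ?_ (Eventually.of_forall fun y => by simpa using hC y)
  refine ((continuous_add_mul_I_cpow hd p).mul ?_).aestronglyMeasurable
  exact Continuous.cpow (by fun_prop) continuous_const (sub_mul_I_mem_slitPlane he)

theorem tendsto_cpow_mul_cpow_cocompact {d e : ℂ} (hd : 0 < d.re) (he : 0 < e.re) {p q : ℂ}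
    (hpq : (p + q).re < 0) :
    Tendsto (fun y : ℝ => (d + y * I) ^ p * (e - y * I) ^ q) (cocompact ℝ) (𝓝 0) := by
  obtain ⟨C, hC⟩ := exists_norm_cpow_mul_cpow_le hd he p q
  refine squeeze_zero_norm hC ?_
  have h1 : Tendsto (fun y : ℝ => 1 + |y|) (cocompact ℝ) atTop :=
    tendsto_atTop_add_const_left _ _ (tendsto_norm_cocompact_atTop (E := ℝ))
  have h2 := (tendsto_rpow_neg_atTop (y := -(p + q).re) (by linarith)).comp h1
  simpa [Function.comp_def] using h2.const_mul C

theorem integrable_add_mul_I_cpow {d : ℂ} (hd : 0 < d.re) {p : ℂ} (hp : p.re < -1) :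
    Integrable fun y : ℝ => (d + y * I) ^ p := by
  simpa using integrable_cpow_mul_cpow hd (e := 1) (by simp) (p := p) (q := 0) (by simpa using hp)

/-- Integration by parts. -/
theorem integral_cpow_mul_cpow_sub_one {d e : ℂ} (hd : 0 < d.re) (he : 0 < e.re) {p q : ℂ}
    (hpq : (p + q).re < 0) :
    p * ∫ y : ℝ, (d + y * I) ^ (p - 1) * (e - y * I) ^ q =
      q * ∫ y : ℝ, (d + y * I) ^ p * (e - y * I) ^ (q - 1) := by
  have hi1 := integrable_cpow_mul_cpow hd he (p := p - 1) (q := q) (by simp at hpq ⊢; linarith)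
  have hi2 := integrable_cpow_mul_cpow hd he (p := p) (q := q - 1) (by simp at hpq ⊢; linarith)
  have hderiv : ∀ y : ℝ, HasDerivAt (fun y : ℝ => (d + y * I) ^ p * (e - y * I) ^ q)
      ((p * I) * ((d + y * I) ^ (p - 1) * (e - y * I) ^ q) -
        (q * I) * ((d + y * I) ^ p * (e - y * I) ^ (q - 1))) y := fun y => by
    have h0 : HasDerivAt (fun v : ℂ => v * I) (1 * I) (y : ℂ) := (hasDerivAt_id _).mul_const I
    have h1 := (h0.const_add d).cpow_const (c := p) (add_mul_I_mem_slitPlane hd y)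
    have h2 := (h0.const_sub e).cpow_const (c := q) (sub_mul_I_mem_slitPlane he y)
    refine (h1.mul h2).comp_ofReal.congr_deriv ?_
    ring
  have ht := tendsto_cpow_mul_cpow_cocompact hd he hpq
  have h := integral_of_hasDerivAt_of_tendsto hderiv
    ((hi1.const_mul (p * I)).sub (hi2.const_mul (q * I)))
    (ht.mono_left atBot_le_cocompact) (ht.mono_left atTop_le_cocompact)
  rw [integral_sub (hi1.const_mul _) (hi2.const_mul _), integral_const_mul, integral_const_mul,
    sub_zero] at h
  linear_combination (-I) * h + (p * (∫ y : ℝ, (d + y * I) ^ (p - 1) * (e - y * I) ^ q) -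
    q * ∫ y : ℝ, (d + y * I) ^ p * (e - y * I) ^ (q - 1)) * I_sq

/-- Raising the first exponent by one in the beta integral. -/
theorem add_mul_integral_cpow_mul_cpow {d e : ℂ} (hd : 0 < d.re) (he : 0 < e.re) {p q : ℂ}
    (hpq : (p + q).re < 0) :
    p * (d + e) * ∫ y : ℝ, (d + y * I) ^ (p - 1) * (e - y * I) ^ (q - 1) =
      (p + q) * ∫ y : ℝ, (d + y * I) ^ p * (e - y * I) ^ (q - 1) := by

  have hi1 := integrable_cpow_mul_cpow hd he (p := p - 1) (q := q) (by simp at hpq ⊢; linarith)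
  have hi2 := integrable_cpow_mul_cpow hd he (p := p) (q := q - 1) (by simp at hpq ⊢; linarith)
  have hsplit : (d + e) * ∫ y : ℝ, (d + y * I) ^ (p - 1) * (e - y * I) ^ (q - 1) =
      (∫ y : ℝ, (d + y * I) ^ p * (e - y * I) ^ (q - 1)) +
        ∫ y : ℝ, (d + y * I) ^ (p - 1) * (e - y * I) ^ q := by
    rw [← integral_const_mul, ← integral_add hi2 hi1]
    congr 1 with y
    have hd' := slitPlane_ne_zero (add_mul_I_mem_slitPlane hd y)
    have he' := slitPlane_ne_zero (sub_mul_I_mem_slitPlane he y)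
    rw [cpow_sub _ _ hd', cpow_sub _ _ he', cpow_one, cpow_one]
    field_simp
    ring
  rw [mul_assoc, hsplit, mul_add, integral_cpow_mul_cpow_sub_one hd he hpq]
  ring

/-- The inverse Laplace transform of `z ↦ z ^ (-a)`. -/
theorem integral_add_mul_I_cpow_mul_exp {a : ℂ} (ha : 1 < a.re) {c : ℝ} (hc : 0 < c) {x : ℝ}
    (hx : 0 < x) :
    Gamma a * ∫ y : ℝ, ((c : ℂ) + y * I) ^ (-a) * exp (x * y * I) =
      2 * Real.pi * ((x : ℂ) ^ (a - 1) * exp (-(c * x))) := by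
  have ha0 : 0 < a.re := one_pos.trans ha
  set f : ℝ → ℂ := (Ioi (0 : ℝ)).indicator fun t : ℝ => (t : ℂ) ^ (a - 1) * exp (-(c * t)) with hf
  have hfi : Integrable f := by
    rw [hf, integrable_indicator_iff measurableSet_Ioi]
    exact integrableOn_cpow_mul_exp_neg_mul ha0 (by simpa using hc)
  have hF : FourierTransform.fourier f =
      fun ξ : ℝ => ((c : ℂ) + (2 * Real.pi * ξ : ℝ) * I) ^ (-a) * Gamma a := by
    ext ξ
    rw [Real.fourier_eq', ← integral_cpow_mul_exp_neg_mul_Ioi_of_re_pos ha0 (by simpa using hc),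
      ← integral_indicator measurableSet_Ioi]
    congr 1 with t
    by_cases ht : t ∈ Ioi (0 : ℝ)
    · simp only [hf, indicator_of_mem ht, smul_eq_mul]
      rw [mul_left_comm, ← exp_add]
      congr 2
      simp
      ring
    · simp [hf, indicator_of_notMem ht]
  have hcont : ContinuousAt f x := by
    have h : ContinuousAt (fun t : ℝ => (t : ℂ) ^ (a - 1) * exp (-(c * t))) x :=
      (continuousAt_ofReal_cpow_const _ _ (Or.inr hx.ne')).mul (by fun_prop)
    refine h.congr ?_
    filter_upwards [Ioi_mem_nhds hx] with t ht
    rw [hf, indicator_of_mem ht]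
  have hFi : Integrable (FourierTransform.fourier f) := by
    rw [hF]
    exact ((integrable_add_mul_I_cpow (d := c) (by simpa using hc) (p := -a)
      (by simpa using ha)).comp_mul_left' (R := 2 * Real.pi) (by positivity)).mul_const _
  have hinv := hfi.fourierInv_fourier_eq hFi hcont
  rw [hF, Real.fourierInv_eq', hf, indicator_of_mem (show x ∈ Ioi (0 : ℝ) from hx)] at hinv
  rw [← hinv]
  have hsub := Measure.integral_comp_mul_left
    (fun y : ℝ => ((c : ℂ) + y * I) ^ (-a) * exp (x * y * I)) (2 * Real.pi)
  have hint : (∫ v : ℝ, exp ((2 * Real.pi * inner ℝ v x : ℝ) * I) •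
      (((c : ℂ) + (2 * Real.pi * v : ℝ) * I) ^ (-a) * Gamma a)) =
      Gamma a * ∫ v : ℝ, ((c : ℂ) + (2 * Real.pi * v : ℝ) * I) ^ (-a) *
        exp (x * (2 * Real.pi * v : ℝ) * I) := by
    rw [← integral_const_mul]
    congr 1 with v
    have h : ((2 * Real.pi * inner ℝ v x : ℝ) : ℂ) = x * (2 * Real.pi * v : ℝ) := by
      simp
      ring
    rw [h, smul_eq_mul]
    ring
  rw [hint, hsub, abs_of_pos (by positivity), real_smul]
  push_cast
  have : (Real.pi : ℂ) ≠ 0 := ofReal_ne_zero.mpr Real.pi_ne_zero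
  generalize (∫ y : ℝ, ((c : ℂ) + y * I) ^ (-a) * exp (x * y * I)) = J
  field_simp

theorem integral_cpow_mul_cpow_of_one_lt_re {a τ : ℂ} (ha : 1 < a.re) (hτ : 0 < τ.re) {c : ℝ}
    (hc : 0 < c) {d : ℂ} (hd : 0 < d.re) :
    Gamma τ * Gamma a * ∫ y : ℝ, ((c : ℂ) + y * I) ^ (-a) * (d - y * I) ^ (-τ) =
      2 * Real.pi * (Gamma (a + τ - 1) * (c + d) ^ (-(a + τ - 1))) := by
  set g : ℝ → ℝ → ℂ := fun y x =>
    exp (x * y * I) * (((c : ℂ) + y * I) ^ (-a) * ((x : ℂ) ^ (τ - 1) * exp (-(d * x)))) with hg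
  have hgi : Integrable (Function.uncurry g) (volume.prod (volume.restrict (Ioi 0))) := by
    refine Integrable.bdd_mul (c := 1) ((integrable_add_mul_I_cpow (d := c) (by simpa using hc)
      (p := -a) (by simpa using ha)).mul_prod (integrableOn_cpow_mul_exp_neg_mul hτ hd)) ?_ ?_
    · exact Continuous.aestronglyMeasurable (by fun_prop)
    · refine Eventually.of_forall fun p => ?_
      rw [← ofReal_mul, norm_exp_ofReal_mul_I]
  have h1 : ∀ y : ℝ, ∫ x in Ioi (0 : ℝ), g y x =
      Gamma τ * (((c : ℂ) + y * I) ^ (-a) * (d - y * I) ^ (-τ)) := fun y => by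
    have h := integral_cpow_mul_exp_neg_mul_Ioi_of_re_pos hτ (z := d - y * I) (by simpa using hd)
    rw [mul_left_comm, mul_comm (Gamma τ), ← h, ← integral_const_mul]
    congr 1 with x
    rw [show -((d - y * I) * (x : ℂ)) = x * y * I + -(d * x) by ring, exp_add]
    ring
  have h2 : ∀ x ∈ Ioi (0 : ℝ), Gamma a * ∫ y : ℝ, g y x =
      2 * Real.pi * ((x : ℂ) ^ (a + τ - 1 - 1) * exp (-((c + d) * x))) := fun x hx => by
    have h := integral_add_mul_I_cpow_mul_exp ha hc hx
    have hint : ∫ y : ℝ, g y x = (x : ℂ) ^ (τ - 1) * exp (-(d * x)) *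
        ∫ y : ℝ, ((c : ℂ) + y * I) ^ (-a) * exp (x * y * I) := by
      rw [← integral_const_mul]
      congr 1 with y
      ring
    have hx' : (x : ℂ) ≠ 0 := ofReal_ne_zero.mpr (ne_of_gt hx)
    rw [hint, mul_left_comm, h, show a + τ - 1 - 1 = (a - 1) + (τ - 1) by ring,
      cpow_add _ _ hx', show -((c + d) * (x : ℂ)) = -(c * x) + -(d * x) by ring, exp_add]
    ring
  calc _ = Gamma a * ∫ y : ℝ, ∫ x in Ioi (0 : ℝ), g y x := by
        simp_rw [h1]
        rw [integral_const_mul]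
        ring
    _ = ∫ x in Ioi (0 : ℝ), Gamma a * ∫ y : ℝ, g y x := by
        rw [integral_integral_swap hgi, integral_const_mul]
    _ = _ := by
        rw [setIntegral_congr_fun measurableSet_Ioi h2, integral_const_mul,
          integral_cpow_mul_exp_neg_mul_Ioi_of_re_pos (by simp; linarith) (by simp; linarith)]
        ring

/-- Cauchy's beta integral. -/
theorem integral_cpow_mul_cpow {a τ : ℂ} (ha : 0 < a.re) (hτ : 0 < τ.re)
    (haτ : 1 < (a + τ).re) {c : ℝ} (hc : 0 < c) {d : ℂ} (hd : 0 < d.re) :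
    Gamma τ * Gamma a * ∫ y : ℝ, ((c : ℂ) + y * I) ^ (-a) * (d - y * I) ^ (-τ) =
      2 * Real.pi * (Gamma (a + τ - 1) * (c + d) ^ (-(a + τ - 1))) := by
  have h := integral_cpow_mul_cpow_of_one_lt_re (a := a + 1) (by simpa using ha) hτ hc hd
  have hrec := add_mul_integral_cpow_mul_cpow (d := c) (by simpa using hc) hd (p := -a)
    (q := 1 - τ) (by simp at haτ ⊢; linarith)
  rw [show -a - 1 = -(a + 1) by ring, show 1 - τ - 1 = -τ by ring] at hrec
  have ha0 : a ≠ 0 := fun h => by simp [h] at ha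
  have hb0 : a + τ - 1 ≠ 0 := fun h => by
    have := congrArg re h
    simp at this haτ
    linarith
  have hw : (c : ℂ) + d ≠ 0 := fun h => by
    have := congrArg re h
    simp at this
    linarith
  rw [Gamma_add_one _ ha0, show a + 1 + τ - 1 = (a + τ - 1) + 1 by ring, Gamma_add_one _ hb0,
    neg_add (a + τ - 1), cpow_add _ _ hw, cpow_neg_one] at h
  apply mul_left_cancel₀ hb0
  have h' := congrArg (fun t => t * ((c : ℂ) + d)) h
  have hc1 : ((c : ℂ) + d)⁻¹ * (c + d) = 1 := inv_mul_cancel₀ hw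
  linear_combination h' + Gamma τ * Gamma a * hrec + 2 * Real.pi * (a + τ - 1) *
    Gamma (a + τ - 1) * (c + d) ^ (-(a + τ - 1)) * hc1

end CauchyBeta

theorem stmt2 (s : ℂ) (hs0 : 0 ≤ s.re) (hs1 : s.re < 1) (c : ℝ) (hc0 : 0 < c)
    (hc1 : c < 1 - s.re) (α τ : ℂ) (hτ0 : 0 < τ.re) (hτ1 : τ.re < 1)
    (hατ : 0 < (α + τ).re) :
    Integrable (fun y : ℝ =>
      ((c : ℂ) + y * Complex.I) ^ (-α - 1) *
        (1 - s - ((c : ℂ) + y * Complex.I)) ^ (-τ)) ∧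
    ∫ y : ℝ,
        ((c : ℂ) + y * Complex.I) ^ (-α - 1) *
          (1 - s - ((c : ℂ) + y * Complex.I)) ^ (-τ)
      = 2 * Real.pi *
          (Complex.Gamma (α + τ) / (Complex.Gamma τ * Complex.Gamma (α + 1))) *
          (1 - s) ^ (-α - τ) := by
  have hd : 0 < (1 - s - c).re := by
    simp only [sub_re, one_re, ofReal_re]
    linarith
  have hα : 0 < (α + 1).re := by
    simp only [add_re, one_re] at hατ ⊢
    linarith
  have hατ' : 1 < (α + 1 + τ).re := by
    simp only [add_re, one_re] at hατ ⊢
    linarith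
  simp_rw [← sub_sub (1 - s) (c : ℂ), show -α - 1 = -(α + 1) by ring]
  refine ⟨integrable_cpow_mul_cpow (by simpa using hc0) hd
    (by simp only [add_re, neg_re, one_re] at hατ' ⊢; linarith), ?_⟩
  have h := integral_cpow_mul_cpow hα hτ0 hατ' hc0 hd
  rw [show α + 1 + τ - 1 = α + τ by ring, add_sub_cancel, neg_add' α τ] at h
  have h1 := Gamma_ne_zero_of_re_pos hτ0
  have h2 := Gamma_ne_zero_of_re_pos hα
  apply mul_left_cancel₀ (mul_ne_zero h1 h2)
  rw [h]
  field_simp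
end
end

section
/- Let n ≥ 1, λ_0 ∈ ℂ, and μ = (μ_1,…,μ_n), λ = (λ_1,…,λ_n) ∈ ℂⁿ with Re μ_i > 0 and Re(λ_i − μ_i) > 0 for all i. Then for every x ∈ ℂⁿ with |x_1| + ⋯ + |x_n| < 1, Lauricella's series F_A(λ_0, μ, λ; x) = Σ_{m∈ℕⁿ} [(λ_0)_{|m|} (μ)_m / ((λ)_m · m!)] x^m converges absolutely and equals ∏_{i=1}^n [Γ(λ_i)/(Γ(μ_i)Γ(λ_i−μ_i))] · ∫_{(0,1)^n} (∏_{i=1}^n t_i^{μ_i−1}(1−t_i)^{λ_i−μ_i−1}) · (1 − t_1x_1 − ⋯ − t_nx_n)^{−λ_0} dt, the integral being absolutely convergent (note |t_1x_1+⋯+t_nx_n| < 1 on the domain, so the last factor is a principal power of a base off (−∞,0]). -/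
open MeasureTheory Complex

noncomputable section

theorem ascPochhammer_eval_eq_poch (a : ℂ) (k : ℕ) : (ascPochhammer ℂ k).eval a = poch a k := by
  induction k with
  | zero => simp [poch]
  | succ k ih => rw [ascPochhammer_succ_eval, ih, poch, poch, Finset.prod_range_succ]

theorem Gamma_add_natCast_eq_poch_mul {a : ℂ} (ha : 0 < a.re) (k : ℕ) :
    Gamma (a + k) = poch a k * Gamma a := by
  induction k with
  | zero => simp [poch]
  | succ k ih =>
    have hne : a + k ≠ 0 := fun h => by
      have := congrArg re h
      simp only [add_re, natCast_re, zero_re] at this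
      have : (0 : ℝ) ≤ k := k.cast_nonneg
      linarith
    rw [Nat.cast_succ, ← add_assoc, Gamma_add_one _ hne, ih, poch, poch, Finset.prod_range_succ]
    ring

/-- The binomial series of `(1 - z) ^ (-a)`. -/
theorem hasSum_poch_mul_pow (a : ℂ) {z : ℂ} (hz : ‖z‖ < 1) :
    HasSum (fun k => poch a k / (k.factorial : ℂ) * z ^ k) ((1 - z) ^ (-a)) := by
  have h := (one_div_one_sub_cpow_hasFPowerSeriesOnBall_zero a).hasSum (y := z) (by
    rw [← ENNReal.ofReal_one, Metric.eball_ofReal]; simpa using hz)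
  rw [zero_add, one_div, ← cpow_neg] at h
  refine h.congr_fun fun k => ?_
  have hk : (k.factorial : ℂ) ≠ 0 := by exact_mod_cast k.factorial_ne_zero
  have := Ring.factorial_nsmul_multichoose_eq_ascPochhammer a k
  rw [Polynomial.ascPochhammer_smeval_eq_eval, ascPochhammer_eval_eq_poch, Ring.multichoose_eq,
    nsmul_eq_mul] at this
  simp [FormalMultilinearSeries.ofScalars, ← this, hk]

section Multinomial

variable {ι : Type*} [Fintype ι]

theorem norm_poch_mul_prod_pow (a : ℂ) (x : ι → ℂ) (m : ι → ℕ) :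
    ‖poch a (∑ i, m i) / (∏ i, ((m i).factorial : ℂ)) * ∏ i, x i ^ m i‖ =
      ‖poch a (∑ i, m i)‖ / (∏ i, ((m i).factorial : ℝ)) * ∏ i, ‖x i‖ ^ m i := by
  simp

variable [DecidableEq ι]

theorem existsUnique_mem_piAntidiag_univ (m : ι → ℕ) :
    ∃! k, m ∈ ((Finset.univ.piAntidiag k : Finset (ι → ℕ)) : Set (ι → ℕ)) :=
  ⟨∑ i, m i, by simp, by simp +contextual⟩

theorem sum_piAntidiag_div_prod_factorial {𝕜 : Type*} [Field 𝕜] [CharZero 𝕜] (c : ℕ → 𝕜)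
    (y : ι → 𝕜) (k : ℕ) :
    ∑ m ∈ Finset.univ.piAntidiag k,
      c (∑ i, m i) / (∏ i, ((m i).factorial : 𝕜)) * ∏ i, y i ^ m i =
      c k / (k.factorial : 𝕜) * (∑ i, y i) ^ k := by
  rw [Finset.sum_pow_eq_sum_piAntidiag, Finset.mul_sum]
  refine Finset.sum_congr rfl fun m hm => ?_
  obtain rfl : ∑ i, m i = k := by simpa using hm
  have h : (∏ i, ((m i).factorial : 𝕜)) * (Nat.multinomial Finset.univ m : 𝕜) =
      ((∑ i, m i).factorial : 𝕜) := by
    exact_mod_cast Nat.multinomial_spec Finset.univ m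
  have h1 : (∏ i, ((m i).factorial : 𝕜)) ≠ 0 :=
    Finset.prod_ne_zero_iff.2 fun i _ => by exact_mod_cast (m i).factorial_ne_zero
  have h2 : (Nat.multinomial Finset.univ m : 𝕜) ≠ 0 := by
    exact_mod_cast (Nat.multinomial_pos Finset.univ m).ne'
  rw [← h]
  field_simp

theorem summable_norm_poch_mul_prod_pow (a : ℂ) {x : ι → ℂ} (hx : ∑ i, ‖x i‖ < 1) :
    Summable fun m : ι → ℕ =>
      ‖poch a (∑ i, m i)‖ / (∏ i, ((m i).factorial : ℝ)) * ∏ i, ‖x i‖ ^ m i := by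
  have h0 : 0 ≤ ∑ i, ‖x i‖ := Finset.sum_nonneg fun _ _ => norm_nonneg _
  have hz : ‖((∑ i, ‖x i‖ : ℝ) : ℂ)‖ < 1 := by rwa [norm_real, Real.norm_of_nonneg h0]
  have hk := (hasSum_poch_mul_pow a hz).summable.norm
  simp only [norm_mul, norm_div, norm_pow, norm_real, Real.norm_of_nonneg h0, norm_natCast,
    ← sum_piAntidiag_div_prod_factorial fun k => ‖poch a k‖] at hk
  generalize hf : (fun m : ι → ℕ =>
    ‖poch a (∑ i, m i)‖ / (∏ i, ((m i).factorial : ℝ)) * ∏ i, ‖x i‖ ^ m i) = f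
  have hfm (m) := congrFun hf m
  simp only [hfm] at hk
  have hf0 : 0 ≤ f := fun m => by rw [← hfm]; exact mul_nonneg (by positivity) (by positivity)
  refine (summable_partition hf0 existsUnique_mem_piAntidiag_univ).2
    ⟨fun k => (Finset.hasSum _ f).summable, hk.congr fun k => ?_⟩
  exact (Finset.tsum_subtype' _ f).symm

/-- The multinomial expansion of `(1 - ∑ xᵢ) ^ (-a)`. -/
theorem hasSum_poch_mul_prod_pow (a : ℂ) {x : ι → ℂ} (hx : ∑ i, ‖x i‖ < 1) :
    HasSum (fun m : ι → ℕ =>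
      poch a (∑ i, m i) / (∏ i, ((m i).factorial : ℂ)) * ∏ i, x i ^ m i)
      ((1 - ∑ i, x i) ^ (-a)) := by
  have hs : Summable fun m : ι → ℕ =>
      poch a (∑ i, m i) / (∏ i, ((m i).factorial : ℂ)) * ∏ i, x i ^ m i :=
    ((summable_norm_poch_mul_prod_pow a hx).congr fun m =>
      (norm_poch_mul_prod_pow a x m).symm).of_norm
  have hk := hasSum_poch_mul_pow a ((norm_sum_le _ _).trans_lt hx)
  simp only [← sum_piAntidiag_div_prod_factorial (poch a)] at hk
  generalize hf : (fun m : ι → ℕ =>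
    poch a (∑ i, m i) / (∏ i, ((m i).factorial : ℂ)) * ∏ i, x i ^ m i) = f at hs ⊢
  have hfm (m) := congrFun hf m
  simp only [hfm] at hk
  let e := Set.sigmaEquiv (fun k => ((Finset.univ.piAntidiag k : Finset (ι → ℕ)) : Set (ι → ℕ)))
    existsUnique_mem_piAntidiag_univ
  have h := ((e.hasSum_iff).2 hs.hasSum).sigma fun k =>
    (Finset.univ.piAntidiag k : Finset (ι → ℕ)).hasSum f
  exact h.unique hk ▸ hs.hasSum

end Multinomial

section Beta

variable {u v : ℂ}

theorem integrableOn_beta (hu : 0 < u.re) (hv : 0 < v.re) :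
    IntegrableOn (fun t : ℝ => (t : ℂ) ^ (u - 1) * ((1 - t : ℝ) : ℂ) ^ (v - 1))
      (Set.Ioo 0 1) := by
  rw [← integrableOn_Ioc_iff_integrableOn_Ioo,
    ← intervalIntegrable_iff_integrableOn_Ioc_of_le zero_le_one]
  simpa using betaIntegral_convergent hu hv

theorem beta_mul_pow {t : ℝ} (ht : t ∈ Set.Ioo (0 : ℝ) 1) (k : ℕ) :
    (t : ℂ) ^ (u - 1) * ((1 - t : ℝ) : ℂ) ^ (v - 1) * (t : ℂ) ^ k =
      (t : ℂ) ^ (u + k - 1) * ((1 - t : ℝ) : ℂ) ^ (v - 1) := by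
  have : (t : ℂ) ≠ 0 := by exact_mod_cast ht.1.ne'
  rw [show u + k - 1 = u - 1 + k by ring, cpow_add _ _ this, cpow_natCast]
  ring

theorem integral_beta_mul_pow (hu : 0 < u.re) (hv : 0 < v.re) (k : ℕ) :
    Gamma (u + v) / (Gamma u * Gamma v) * ∫ t in Set.Ioo (0 : ℝ) 1,
      (t : ℂ) ^ (u - 1) * ((1 - t : ℝ) : ℂ) ^ (v - 1) * (t : ℂ) ^ k =
      poch u k / poch (u + v) k := by
  have huv : 0 < (u + v).re := by simpa using add_pos hu hv
  have huk : 0 < (u + k).re := by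
    simpa using add_pos_of_pos_of_nonneg hu (k.cast_nonneg : (0 : ℝ) ≤ k)
  have huvk : 0 < (u + v + k).re := by
    rw [add_re, natCast_re]; exact add_pos_of_pos_of_nonneg huv k.cast_nonneg
  have h := Gamma_mul_Gamma_eq_betaIntegral huk hv
  rw [show u + k + v = u + v + k by ring, Gamma_add_natCast_eq_poch_mul hu] at h
  have h1 := Gamma_ne_zero_of_re_pos huvk
  rw [Gamma_add_natCast_eq_poch_mul huv] at h h1
  have h2 := left_ne_zero_of_mul h1
  have h3 := Gamma_ne_zero_of_re_pos hu
  have h4 := Gamma_ne_zero_of_re_pos hv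
  rw [setIntegral_congr_fun measurableSet_Ioo fun t ht => beta_mul_pow ht k,
    ← integral_Ioc_eq_integral_Ioo, ← intervalIntegral.integral_of_le zero_le_one]
  have : (∫ t in (0 : ℝ)..1, (t : ℂ) ^ (u + k - 1) * ((1 - t : ℝ) : ℂ) ^ (v - 1)) =
      betaIntegral (u + k) v := by
    simp [betaIntegral]
  rw [this, eq_div_iff h2, div_mul_eq_mul_div, div_mul_eq_mul_div, div_eq_iff (mul_ne_zero h3 h4)]
  linear_combination -h

end Beta

theorem stmt4 (n : ℕ) (hn : 1 ≤ n) (lam0 : ℂ) (μ lam : Fin n → ℂ)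
    (hμ : ∀ i, 0 < (μ i).re) (hlm : ∀ i, 0 < (lam i - μ i).re)
    (x : Fin n → ℂ) (hx : ∑ i, ‖x i‖ < 1) :
    Summable (fun m : Fin n → ℕ =>
      ‖poch lam0 (∑ i, m i) * (∏ i, poch (μ i) (m i)) /
          ((∏ i, poch (lam i) (m i)) * ∏ i, (Nat.factorial (m i) : ℂ)) *
          ∏ i, x i ^ m i‖) ∧
    IntegrableOn
      (fun t : Fin n → ℝ =>
        (∏ i, (t i : ℂ) ^ (μ i - 1) * ((1 - t i : ℝ) : ℂ) ^ (lam i - μ i - 1)) *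
          (1 - ∑ i, (t i : ℂ) * x i) ^ (-lam0))
      (Set.univ.pi fun _ : Fin n => Set.Ioo (0 : ℝ) 1) ∧
    (∑' m : Fin n → ℕ,
        poch lam0 (∑ i, m i) * (∏ i, poch (μ i) (m i)) /
          ((∏ i, poch (lam i) (m i)) * ∏ i, (Nat.factorial (m i) : ℂ)) *
          ∏ i, x i ^ m i)
      = (∏ i, Complex.Gamma (lam i) /
            (Complex.Gamma (μ i) * Complex.Gamma (lam i - μ i))) *
          ∫ t in Set.univ.pi fun _ : Fin n => Set.Ioo (0 : ℝ) 1,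
            (∏ i, (t i : ℂ) ^ (μ i - 1) * ((1 - t i : ℝ) : ℂ) ^ (lam i - μ i - 1)) *
              (1 - ∑ i, (t i : ℂ) * x i) ^ (-lam0) := by
  let I : Set (Fin n → ℝ) := Set.univ.pi fun _ => Set.Ioo (0 : ℝ) 1
  let w : Fin n → ℝ → ℂ := fun i t =>
    (t : ℂ) ^ (μ i - 1) * ((1 - t : ℝ) : ℂ) ^ (lam i - μ i - 1)
  let W : (Fin n → ℝ) → ℂ := fun t => ∏ i, w i (t i)
  let C : ℂ := ∏ i, Gamma (lam i) / (Gamma (μ i) * Gamma (lam i - μ i))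
  let c : (Fin n → ℕ) → ℂ := fun m =>
    poch lam0 (∑ i, m i) / (∏ i, ((m i).factorial : ℂ)) * ∏ i, x i ^ m i
  let F : (Fin n → ℕ) → (Fin n → ℝ) → ℂ := fun m t => W t * (c m * ∏ i, (t i : ℂ) ^ m i)
  have hI : MeasurableSet I := MeasurableSet.univ_pi fun _ => measurableSet_Ioo
  have hvol : (volume : Measure (Fin n → ℝ)).restrict I =
      Measure.pi fun _ => volume.restrict (Set.Ioo (0 : ℝ) 1) :=
    Measure.restrict_pi_pi _ _
  have hW : IntegrableOn W I := by
    rw [IntegrableOn, hvol]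
    exact Integrable.fintype_prod fun i => integrableOn_beta (hμ i) (hlm i)
  have hc : Summable fun m => ‖c m‖ :=
    (summable_norm_poch_mul_prod_pow lam0 hx).congr fun m => (norm_poch_mul_prod_pow lam0 x m).symm
  have hnorm {t : Fin n → ℝ} (ht : t ∈ I) (i : Fin n) : ‖(t i : ℂ)‖ ≤ 1 := by
    have := ht i trivial
    rw [norm_real, Real.norm_of_nonneg this.1.le]
    exact this.2.le
  have hbound {t : Fin n → ℝ} (ht : t ∈ I) (m : Fin n → ℕ) :
      ‖c m * ∏ i, (t i : ℂ) ^ m i‖ ≤ ‖c m‖ := by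
    rw [norm_mul, norm_prod]
    refine mul_le_of_le_one_right (norm_nonneg _) (Finset.prod_le_one (fun _ _ => norm_nonneg _)
      fun i _ => ?_)
    rw [norm_pow]
    exact pow_le_one₀ (norm_nonneg _) (hnorm ht i)
  have hsum {t : Fin n → ℝ} (ht : t ∈ I) :
      HasSum (fun m => c m * ∏ i, (t i : ℂ) ^ m i) ((1 - ∑ i, (t i : ℂ) * x i) ^ (-lam0)) := by
    refine (hasSum_poch_mul_prod_pow lam0 (x := fun i => (t i : ℂ) * x i) ?_).congr_fun fun m => ?_
    · refine (Finset.sum_le_sum fun i _ => ?_).trans_lt hx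
      rw [norm_mul]
      exact mul_le_of_le_one_left (norm_nonneg _) (hnorm ht i)
    · simp only [c, mul_pow, Finset.prod_mul_distrib]
      ring
  have hF (m : Fin n → ℕ) : IntegrableOn (F m) I :=
    hW.mul_bdd (c := ‖c m‖) (Measurable.aestronglyMeasurable (by fun_prop))
      (ae_restrict_of_forall_mem hI fun t ht => hbound ht m)
  have hFsum : Summable fun m => ∫ t in I, ‖F m t‖ := by
    refine Summable.of_nonneg_of_le (fun m => integral_nonneg fun _ => norm_nonneg _) (fun m => ?_)
      (hc.mul_left (∫ t in I, ‖W t‖))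
    rw [← integral_mul_const]
    refine setIntegral_mono_on (hF m).norm (hW.norm.mul_const _) hI fun t ht => ?_
    rw [norm_mul]
    exact mul_le_mul_of_nonneg_left (hbound ht m) (norm_nonneg _)
  have hterm (m : Fin n → ℕ) : C * ∫ t in I, F m t =
      poch lam0 (∑ i, m i) * (∏ i, poch (μ i) (m i)) /
        ((∏ i, poch (lam i) (m i)) * ∏ i, (Nat.factorial (m i) : ℂ)) * ∏ i, x i ^ m i := by
    have h : ∀ t, F m t = c m * ∏ i, w i (t i) * (t i : ℂ) ^ m i := fun t => by
      simp only [F, W, Finset.prod_mul_distrib]; ring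
    have hβ (i : Fin n) := integral_beta_mul_pow (hμ i) (hlm i) (m i)
    simp only [add_sub_cancel] at hβ
    simp only [h]
    rw [integral_const_mul, hvol,
      integral_fintype_prod_eq_prod fun i (s : ℝ) => w i s * (s : ℂ) ^ m i,
      mul_left_comm, ← Finset.prod_mul_distrib, Finset.prod_congr rfl fun i _ => hβ i,
      Finset.prod_div_distrib]
    simp only [c, div_eq_mul_inv, mul_inv]
    ring
  have hmain := (hasSum_integral_of_summable_integral_norm hF hFsum).mul_left C
  refine ⟨?_, ?_, ?_⟩
  · simp only [← hterm]
    exact hmain.summable.norm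
  · refine hW.mul_bdd (c := ∑' m, ‖c m‖) ?_ (ae_restrict_of_forall_mem hI fun t ht => ?_)
    · exact Measurable.aestronglyMeasurable (by fun_prop)
    · rw [← (hsum ht).tsum_eq]
      exact tsum_of_norm_bounded hc.hasSum fun m => hbound ht m
  · simp only [← hterm]
    rw [hmain.tsum_eq]
    congr 1
    exact setIntegral_congr_fun hI fun t ht => by
      simp only [F]
      rw [((hsum ht).mul_left (W t)).tsum_eq]
end
end

section
/- Let n ≥ 1, λ = (λ_1,…,λ_n), λ' = (λ'_1,…,λ'_n) ∈ ℂⁿ and μ ∈ ℂ with Re λ_i > 0 for all i and Re(μ − |λ|) > 0. Then for every x ∈ ℂⁿ with |x_i| < 1 for all i, Lauricella's series F_B(λ, λ', μ; x) = Σ_{m∈ℕⁿ} [(λ)_m (λ')_m / ((μ)_{|m|} · m!)] x^m converges absolutely and equals [Γ(μ)/(Γ(λ_1)⋯Γ(λ_n)Γ(μ−|λ|))] · ∫_{Δ_n} (∏_{i=1}^n t_i^{λ_i−1}) (1−|t|)^{μ−|λ|−1} ∏_{i=1}^n (1 − t_i x_i)^{−λ'_i} dt, the integral being absolutely convergent.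 -/
open MeasureTheory Complex

noncomputable section

/-- The scaled beta integrand, extended by zero to the whole real line. -/
def betaKernel (s : ℝ) (a b : ℂ) (u : ℝ) : ℂ :=
  (Set.Ioo 0 s).indicator (fun u : ℝ => (u : ℂ) ^ (a - 1) * ((s - u : ℝ) : ℂ) ^ (b - 1)) u

theorem integral_betaKernel {s : ℝ} (hs : 0 < s) {a b : ℂ} (ha : 0 < a.re) (hb : 0 < b.re) :
    ∫ u, betaKernel s a b u = (s : ℂ) ^ (a + b - 1) * (Gamma a * Gamma b / Gamma (a + b)) := by
  have hab : Gamma (a + b) ≠ 0 := Gamma_ne_zero_of_re_pos (by rw [add_re]; linarith)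
  rw [Gamma_mul_Gamma_eq_betaIntegral ha hb, mul_div_cancel_left₀ _ hab,
    ← betaIntegral_scaled a b hs, intervalIntegral.integral_of_le hs.le,
    integral_Ioc_eq_integral_Ioo]
  simp only [betaKernel]
  rw [integral_indicator measurableSet_Ioo]
  simp

theorem norm_betaKernel (s : ℝ) (a b : ℂ) (u : ℝ) :
    ‖betaKernel s a b u‖ = ‖betaKernel s a.re b.re u‖ := by
  simp only [betaKernel, norm_indicator_eq_indicator_norm]
  refine congrFun (Set.indicator_congr fun u hu => ?_) u
  simp [norm_cpow_eq_rpow_re_of_pos hu.1,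
    norm_cpow_eq_rpow_re_of_pos (sub_pos.2 hu.2), -ofReal_sub]

theorem measurable_betaKernel (s : ℝ) (a b : ℂ) : Measurable (betaKernel s a b) := by
  refine Measurable.indicator ?_ measurableSet_Ioo
  fun_prop

theorem integrable_betaKernel {s : ℝ} (hs : 0 < s) {a b : ℂ} (ha : 0 < a.re) (hb : 0 < b.re) :
    Integrable (betaKernel s a b) := by
  have h : Integrable (betaKernel s a.re b.re) := by
    refine Integrable.of_integral_ne_zero ?_
    have ha' : 0 < (a.re : ℂ).re := by simpa
    have hb' : 0 < (b.re : ℂ).re := by simpa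
    rw [integral_betaKernel hs ha' hb']
    refine mul_ne_zero ?_ (div_ne_zero (mul_ne_zero ?_ ?_) ?_)
    · simp [cpow_eq_zero_iff, hs.ne']
    · exact Gamma_ne_zero_of_re_pos ha'
    · exact Gamma_ne_zero_of_re_pos hb'
    · exact Gamma_ne_zero_of_re_pos (by rw [add_re]; linarith)
  exact h.mono (measurable_betaKernel s a b).aestronglyMeasurable
    (.of_forall fun u => (norm_betaKernel s a b u).le)

/-- The integrand of Dirichlet's integral over the open simplex of size `s`,
extended by zero to the whole space. -/
def dirichletKernel {n : ℕ} (s : ℝ) (a : Fin n → ℂ) (c : ℂ) (t : Fin n → ℝ) : ℂ :=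
  {t : Fin n → ℝ | (∀ i, 0 < t i) ∧ ∑ i, t i < s}.indicator
    (fun t => (∏ i, (t i : ℂ) ^ (a i - 1)) * ((s - ∑ i, t i : ℝ) : ℂ) ^ (c - 1)) t

theorem measurableSet_simplex (n : ℕ) (s : ℝ) :
    MeasurableSet {t : Fin n → ℝ | (∀ i, 0 < t i) ∧ ∑ i, t i < s} := by
  rw [Set.ofPred_and, Set.ofPred_forall]
  exact (MeasurableSet.iInter fun i => measurableSet_lt measurable_const (by fun_prop)).inter
    (measurableSet_lt (by fun_prop) measurable_const)

theorem measurable_dirichletKernel {n : ℕ} (s : ℝ) (a : Fin n → ℂ) (c : ℂ) :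
    Measurable (dirichletKernel s a c) := by
  refine Measurable.indicator ?_ (measurableSet_simplex n s)
  fun_prop

theorem dirichletKernel_of_nonpos {n : ℕ} {s : ℝ} (hs : s ≤ 0) (a : Fin n → ℂ) (c : ℂ) :
    dirichletKernel s a c = 0 := by
  ext t
  refine Set.indicator_of_notMem (fun h => ?_) _
  have := Finset.sum_nonneg fun i (_ : i ∈ Finset.univ) => (h.1 i).le
  linarith [h.2]

theorem dirichletKernel_cons {n : ℕ} (s : ℝ) (a : Fin (n + 1) → ℂ) (c : ℂ) (u : ℝ)
    (t : Fin n → ℝ) :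
    dirichletKernel s a c (Fin.cons u t : Fin (n + 1) → ℝ) =
      (Set.Ioi (0 : ℝ)).indicator (fun u : ℝ => (u : ℂ) ^ (a 0 - 1)) u *
        dirichletKernel (s - u) (fun i => a i.succ) c t := by
  have hlt : u + ∑ i, t i < s ↔ ∑ i, t i < s - u := by constructor <;> intro h <;> linarith
  simp only [dirichletKernel, Set.indicator_apply, Set.mem_ofPred_eq, Set.mem_Ioi,
    Fin.forall_fin_succ, Fin.sum_univ_succ, Fin.prod_univ_succ, Fin.cons_zero, Fin.cons_succ,
    hlt, sub_sub, ite_mul, zero_mul, mul_ite, mul_zero, and_assoc, mul_assoc]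
  split_ifs <;> tauto

theorem norm_dirichletKernel {n : ℕ} (s : ℝ) (a : Fin n → ℂ) (c : ℂ) (t : Fin n → ℝ) :
    (‖dirichletKernel s a c t‖ : ℂ) = dirichletKernel s (fun i => ((a i).re : ℂ)) c.re t := by
  simp only [dirichletKernel, norm_indicator_eq_indicator_norm]
  simp only [Set.indicator_apply, Set.mem_ofPred_eq]
  split_ifs with h
  · rw [norm_mul, norm_prod, norm_cpow_eq_rpow_re_of_pos (sub_pos.2 h.2), ofReal_mul, ofReal_prod,
      ofReal_cpow (sub_pos.2 h.2).le]
    simp only [norm_cpow_eq_rpow_re_of_pos (h.1 _), ofReal_cpow (h.1 _).le]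
    simp
  · simp

theorem integral_dirichletKernel_of_inner {n : ℕ} {s : ℝ} (a : Fin (n + 1) → ℂ) (c : ℂ) {K d : ℂ}
    (h : ∀ r : ℝ, 0 < r →
      ∫ t, dirichletKernel r (fun i => a i.succ) c t = (r : ℂ) ^ (d - 1) * K) (u : ℝ) :
    ∫ t, dirichletKernel s a c (Fin.cons u t : Fin (n + 1) → ℝ) =
      betaKernel s (a 0) d u * K := by
  simp only [dirichletKernel_cons, integral_const_mul, betaKernel, Set.indicator_apply,
    Set.mem_Ioi, Set.mem_Ioo]
  by_cases hu : u < s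
  · rw [h _ (sub_pos.2 hu)]
    by_cases h0 : 0 < u <;> simp [hu, h0, mul_assoc]
  · simp [hu, dirichletKernel_of_nonpos (sub_nonpos.2 (not_lt.1 hu))]

theorem measurePreserving_finCons (n : ℕ) :
    MeasurePreserving (fun p : ℝ × (Fin n → ℝ) => (Fin.cons p.1 p.2 : Fin (n + 1) → ℝ)) := by
  have := (volume_preserving_piFinSuccAbove (fun _ : Fin (n + 1) => ℝ) 0).symm
  convert! this using 2
  ext p
  simp [MeasurableEquiv.piFinSuccAbove_symm_apply]

theorem measurableEmbedding_finCons (n : ℕ) :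
    MeasurableEmbedding (fun p : ℝ × (Fin n → ℝ) => (Fin.cons p.1 p.2 : Fin (n + 1) → ℝ)) := by
  have := (MeasurableEquiv.piFinSuccAbove (fun _ : Fin (n + 1) => ℝ) 0).symm.measurableEmbedding
  convert! this using 2
  simp [MeasurableEquiv.piFinSuccAbove_symm_apply, Fin.consEquiv]

/-- **Dirichlet's integral** over the open simplex of size `s`. -/
theorem integrable_and_integral_dirichletKernel {n : ℕ} (a : Fin n → ℂ) (c : ℂ)
    (ha : ∀ i, 0 < (a i).re) (hc : 0 < c.re) {s : ℝ} (hs : 0 < s) :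
    Integrable (dirichletKernel s a c) ∧ ∫ t, dirichletKernel s a c t =
      (s : ℂ) ^ (∑ i, a i + c - 1) * ((∏ i, Gamma (a i)) * Gamma c / Gamma (∑ i, a i + c)) := by
  induction n generalizing c s with
  | zero =>
    have hval (t : Fin 0 → ℝ) : dirichletKernel s a c t = (s : ℂ) ^ (c - 1) := by
      simp [dirichletKernel, hs]
    constructor
    · rw [funext hval]
      exact integrable_const _
    · have : Gamma c ≠ 0 := Gamma_ne_zero_of_re_pos hc
      simp [hval, this, volume_pi, Measure.real]
  | succ n ih =>
    have hd : 0 < (∑ i, a (Fin.succ i) + c).re := by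
      rw [add_re, re_sum]
      exact add_pos_of_nonneg_of_pos (Finset.sum_nonneg fun i _ => (ha _).le) hc
    have hint : Integrable (fun p : ℝ × (Fin n → ℝ) =>
        dirichletKernel s a c (Fin.cons p.1 p.2 : Fin (n + 1) → ℝ)) := by
      refine (integrable_prod_iff ?_).2 ⟨.of_forall fun u => ?_, ?_⟩
      · exact ((measurable_dirichletKernel s a c).comp
          (measurableEmbedding_finCons n).measurable).aestronglyMeasurable
      · simp only [dirichletKernel_cons]
        refine Integrable.const_mul ?_ _
        rcases le_or_gt (s - u) 0 with h | h
        · rw [dirichletKernel_of_nonpos h]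
          exact integrable_zero _ _ _
        · exact (ih _ c (fun i => ha _) hc h).1
      · suffices h : Integrable fun u : ℝ => ((∫ t : Fin n → ℝ,
            ‖dirichletKernel s a c (Fin.cons u t : Fin (n + 1) → ℝ)‖ : ℝ) : ℂ) from
          h.re.congr (.of_forall fun u => ofReal_re _)
        have hinner (r : ℝ) (hr : 0 < r) :=
          (ih (fun i => ((a (Fin.succ i)).re : ℂ)) c.re (fun i => by simpa using ha _)
            (by simpa using hc) hr).2
        have key := integral_dirichletKernel_of_inner (s := s) (fun i => ((a i).re : ℂ)) c.re hinner
        simp only [← norm_dirichletKernel, integral_complex_ofReal] at key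
        refine Integrable.congr ?_ (.of_forall fun u => (key u).symm)
        refine (integrable_betaKernel hs (by simpa using ha 0) ?_).mul_const _
        simpa [re_sum] using hd
    refine ⟨((measurePreserving_finCons n).integrable_comp_emb
      (measurableEmbedding_finCons n)).1 hint, ?_⟩
    rw [← (measurePreserving_finCons n).integral_comp (measurableEmbedding_finCons n)]
    rw [show (volume : Measure (ℝ × (Fin n → ℝ))) = Measure.prod volume volume from rfl,
      integral_prod _ hint]
    simp only [integral_dirichletKernel_of_inner a c
      (fun r hr => (ih (fun i => a i.succ) c (fun i => ha _) hc hr).2)]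
    rw [integral_mul_const, integral_betaKernel hs (ha 0) hd, Fin.sum_univ_succ,
      Fin.prod_univ_succ, mul_assoc, ← add_assoc]
    have := Gamma_ne_zero_of_re_pos hd
    field_simp

theorem summable_norm_pi_prod {n : ℕ} (f : Fin n → ℕ → ℂ) (hf : ∀ i, Summable fun k => ‖f i k‖) :
    (Summable fun m : Fin n → ℕ => ‖∏ i, f i (m i)‖) ∧
      ∑' m : Fin n → ℕ, ∏ i, f i (m i) = ∏ i, ∑' k, f i k := by
  induction n with
  | zero => exact ⟨(hasSum_fintype _).summable, by simp⟩
  | succ n ih =>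
    obtain ⟨h1, h2⟩ := ih (fun i => f i.succ) fun i => hf _
    constructor
    · rw [← (Fin.consEquiv (fun _ : Fin (n + 1) => ℕ)).summable_iff]
      refine (Summable.mul_norm (hf 0) h1).congr fun p => ?_
      simp [Fin.prod_univ_succ, Fin.consEquiv]
    · rw [← (Fin.consEquiv (fun _ : Fin (n + 1) => ℕ)).tsum_eq, Fin.prod_univ_succ, ← h2,
        tsum_mul_tsum_of_summable_norm (hf 0) h1]
      refine tsum_congr fun p => ?_
      simp [Fin.prod_univ_succ, Fin.consEquiv]

theorem poch_eq_ascPochhammer_eval (a : ℂ) (k : ℕ) : poch a k = (ascPochhammer ℂ k).eval a := by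
  induction k with
  | zero => simp [poch]
  | succ k ih => rw [ascPochhammer_succ_eval, ← ih, poch, Finset.prod_range_succ, poch]

theorem choose_eq_poch_div_factorial (a : ℂ) (k : ℕ) :
    Ring.choose (a + k - 1) k = poch a k / k.factorial := by
  rw [← Ring.multichoose_eq, eq_div_iff (by simp [Nat.factorial_ne_zero]), mul_comm,
    ← nsmul_eq_mul, Ring.factorial_nsmul_multichoose_eq_ascPochhammer,
    Polynomial.ascPochhammer_smeval_eq_eval, poch_eq_ascPochhammer_eval]

theorem summable_norm_binomial (a : ℂ) {z : ℂ} (hz : ‖z‖ < 1) :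
    Summable fun k : ℕ => ‖poch a k / k.factorial * z ^ k‖ := by
  have h := one_div_one_sub_cpow_hasFPowerSeriesOnBall_zero a
  have hz' : z ∈ Metric.eball (0 : ℂ) 1 := by
    rw [← ENNReal.ofReal_one, Metric.eball_ofReal]; simpa using hz
  have := FormalMultilinearSeries.summable_norm_apply _ (Metric.eball_subset_eball h.r_le hz')
  refine this.congr fun k => ?_
  rw [← choose_eq_poch_div_factorial]
  simp [mul_comm]

theorem tsum_binomial (a : ℂ) {z : ℂ} (hz : ‖z‖ < 1) :
    ∑' k : ℕ, poch a k / k.factorial * z ^ k = (1 - z) ^ (-a) := by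
  have h := one_div_one_sub_cpow_hasFPowerSeriesOnBall_zero a
  have hz' : z ∈ Metric.eball (0 : ℂ) 1 := by
    rw [← ENNReal.ofReal_one, Metric.eball_ofReal]; simpa using hz
  have := (h.hasSum hz').tsum_eq
  simp only [zero_add, one_div, ← cpow_neg] at this
  rw [← this]
  refine tsum_congr fun k => ?_
  rw [← choose_eq_poch_div_factorial]
  simp [mul_comm]

theorem dirichletKernel_add_nat {n : ℕ} (s : ℝ) (a : Fin n → ℂ) (c : ℂ) (m : Fin n → ℕ)
    (t : Fin n → ℝ) :
    dirichletKernel s (fun i => a i + m i) c t =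
      (∏ i, (t i : ℂ) ^ m i) * dirichletKernel s a c t := by
  simp only [dirichletKernel, Set.indicator_apply, Set.mem_ofPred_eq]
  split_ifs with h
  · rw [← mul_assoc, ← Finset.prod_mul_distrib]
    congr 1
    refine Finset.prod_congr rfl fun i _ => ?_
    rw [add_sub_right_comm, cpow_add _ _ (ofReal_ne_zero.2 (h.1 i).ne'), cpow_natCast, mul_comm]
  · simp

theorem norm_lt_one_of_mem_openSimplex {n : ℕ} {t : Fin n → ℝ} (ht : t ∈ openSimplex n)
    (i : Fin n) : ‖(t i : ℂ)‖ < 1 := by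
  rw [norm_real, Real.norm_of_nonneg (ht.1 i).le]
  exact (Finset.single_le_sum (fun j _ => (ht.1 j).le) (Finset.mem_univ i)).trans_lt ht.2

theorem norm_mul_lt_one_of_mem_openSimplex {n : ℕ} {t : Fin n → ℝ} (ht : t ∈ openSimplex n)
    {x : Fin n → ℂ} (hx : ∀ i, ‖x i‖ < 1) (i : Fin n) : ‖(t i : ℂ) * x i‖ < 1 := by
  rw [norm_mul]
  exact mul_lt_one_of_nonneg_of_lt_one_left (norm_nonneg _)
    (norm_lt_one_of_mem_openSimplex ht i) (hx i).le

theorem dirichletKernel_one_of_notMem {n : ℕ} (a : Fin n → ℂ) (c : ℂ) {t : Fin n → ℝ}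
    (ht : t ∉ openSimplex n) : dirichletKernel 1 a c t = 0 :=
  Set.indicator_of_notMem ht _

theorem norm_dirichletKernel_add_nat_le {n : ℕ} (a : Fin n → ℂ) (c : ℂ) (m : Fin n → ℕ)
    (t : Fin n → ℝ) :
    ‖dirichletKernel 1 (fun i => a i + m i) c t‖ ≤ ‖dirichletKernel 1 a c t‖ := by
  by_cases ht : t ∈ openSimplex n
  · rw [dirichletKernel_add_nat, norm_mul, norm_prod]
    refine mul_le_of_le_one_left (norm_nonneg _) (Finset.prod_le_one (fun i _ => norm_nonneg _) ?_)
    intro i _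
    rw [norm_pow]
    exact pow_le_one₀ (norm_nonneg _) (norm_lt_one_of_mem_openSimplex ht i).le
  · simp [dirichletKernel_one_of_notMem _ _ ht]

theorem integral_dirichletKernel_add_nat {n : ℕ} (a : Fin n → ℂ) (c : ℂ)
    (ha : ∀ i, 0 < (a i).re) (hc : 0 < c.re) (m : Fin n → ℕ) :
    ∫ t, dirichletKernel 1 (fun i => a i + m i) c t =
      (∏ i, poch (a i) (m i)) / poch (∑ i, a i + c) (∑ i, m i) *
        ((∏ i, Gamma (a i)) * Gamma c / Gamma (∑ i, a i + c)) := by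
  have hre : 0 < (∑ i, a i + c).re := by
    rw [add_re, re_sum]
    exact add_pos_of_nonneg_of_pos (Finset.sum_nonneg fun i _ => (ha _).le) hc
  have hsum : ∑ i, (a i + m i) + c = ∑ i, a i + c + ((∑ i, m i : ℕ) : ℂ) := by
    rw [Finset.sum_add_distrib]; push_cast; ring
  rw [(integrable_and_integral_dirichletKernel (fun i => a i + m i) c
    (fun i => by simpa using add_pos_of_pos_of_nonneg (ha i) (m i).cast_nonneg) hc one_pos).2,
    hsum, ← poch_mul_Gamma hre]
  simp only [← poch_mul_Gamma (ha _), Finset.prod_mul_distrib, ofReal_one, one_cpow, one_mul]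
  rw [div_mul_div_comm, mul_assoc]

/-- The function `t ↦ ∏ (1 - tᵢ xᵢ) ^ (-bᵢ)` times the Dirichlet kernel, expanded in powers. -/
theorem tsum_mul_dirichletKernel_add_nat {n : ℕ} (a b x : Fin n → ℂ) (c : ℂ)
    (hx : ∀ i, ‖x i‖ < 1) (t : Fin n → ℝ) :
    ∑' m : Fin n → ℕ, (∏ i, poch (b i) (m i) / (m i).factorial * x i ^ m i) *
        dirichletKernel 1 (fun i => a i + m i) c t =
      dirichletKernel 1 a c t * ∏ i, (1 - (t i : ℂ) * x i) ^ (-b i) := by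
  by_cases ht : t ∈ openSimplex n
  · have hz := norm_mul_lt_one_of_mem_openSimplex ht hx
    simp only [← tsum_binomial _ (hz _)]
    rw [← (summable_norm_pi_prod _ fun i => summable_norm_binomial (b i) (hz i)).2, ← tsum_mul_left]
    refine tsum_congr fun m => ?_
    rw [dirichletKernel_add_nat, ← mul_assoc, ← Finset.prod_mul_distrib, mul_comm]
    congr 1
    refine Finset.prod_congr rfl fun i _ => ?_
    ring
  · simp [dirichletKernel_one_of_notMem _ _ ht]

theorem stmt5 (n : ℕ) (hn : 1 ≤ n) (lam lam' : Fin n → ℂ) (μ : ℂ)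
    (hlam : ∀ i, 0 < (lam i).re) (hμ : 0 < (μ - ∑ i, lam i).re)
    (x : Fin n → ℂ) (hx : ∀ i, ‖x i‖ < 1) :
    Summable (fun m : Fin n → ℕ =>
      ‖(∏ i, poch (lam i) (m i)) * (∏ i, poch (lam' i) (m i)) /
          (poch μ (∑ i, m i) * ∏ i, (Nat.factorial (m i) : ℂ)) *
          ∏ i, x i ^ m i‖) ∧
    IntegrableOn
      (fun t : Fin n → ℝ =>
        (∏ i, (t i : ℂ) ^ (lam i - 1)) *
          ((1 - ∑ i, t i : ℝ) : ℂ) ^ (μ - (∑ i, lam i) - 1) *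
          ∏ i, (1 - (t i : ℂ) * x i) ^ (-lam' i))
      (openSimplex n) ∧
    (∑' m : Fin n → ℕ,
        (∏ i, poch (lam i) (m i)) * (∏ i, poch (lam' i) (m i)) /
          (poch μ (∑ i, m i) * ∏ i, (Nat.factorial (m i) : ℂ)) *
          ∏ i, x i ^ m i)
      = Complex.Gamma μ /
          ((∏ i, Complex.Gamma (lam i)) * Complex.Gamma (μ - ∑ i, lam i)) *
          ∫ t in openSimplex n,
            (∏ i, (t i : ℂ) ^ (lam i - 1)) *
              ((1 - ∑ i, t i : ℝ) : ℂ) ^ (μ - (∑ i, lam i) - 1) *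
              ∏ i, (1 - (t i : ℂ) * x i) ^ (-lam' i) := by
  set c : ℂ := μ - ∑ i, lam i with hc
  have hμc : ∑ i, lam i + c = μ := by rw [hc]; ring
  have hμ_re : 0 < μ.re := by
    rw [← hμc, add_re, re_sum]
    exact add_pos_of_nonneg_of_pos (Finset.sum_nonneg fun i _ => (hlam _).le) hμ
  set K : ℂ := Gamma μ / ((∏ i, Gamma (lam i)) * Gamma c) with hK
  let coef (m : Fin n → ℕ) : ℂ := ∏ i, poch (lam' i) (m i) / (m i).factorial * x i ^ m i
  let F (m : Fin n → ℕ) (t : Fin n → ℝ) : ℂ :=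
    coef m * dirichletKernel 1 (fun i => lam i + m i) c t
  have hcoef : Summable fun m => ‖coef m‖ :=
    (summable_norm_pi_prod _ fun i => summable_norm_binomial (lam' i) (hx i)).1
  have hker := (integrable_and_integral_dirichletKernel lam c hlam hμ one_pos).1
  have hF_le (m) (t) : ‖F m t‖ ≤ ‖coef m‖ * ‖dirichletKernel 1 lam c t‖ := by
    rw [norm_mul]
    gcongr
    exact norm_dirichletKernel_add_nat_le lam c m t
  have hF_int (m) : Integrable (F m) :=
    ((integrable_and_integral_dirichletKernel (fun i => lam i + m i) c
      (fun i => by simpa using add_pos_of_pos_of_nonneg (hlam i) (m i).cast_nonneg) hμ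
      one_pos).1).const_mul _
  have hF_sum : Summable fun m => ∫ t, ‖F m t‖ := by
    refine .of_nonneg_of_le (fun m => integral_nonneg fun t => norm_nonneg _) (fun m => ?_)
      (hcoef.mul_right (∫ t, ‖dirichletKernel 1 lam c t‖))
    rw [← integral_const_mul]
    exact integral_mono (hF_int m).norm (hker.norm.const_mul _) (hF_le m)
  have hsimplex : MeasurableSet (openSimplex n) := measurableSet_simplex n 1
  have htsum (t : Fin n → ℝ) : ∑' m, F m t = (openSimplex n).indicator (fun t =>
      (∏ i, (t i : ℂ) ^ (lam i - 1)) * ((1 - ∑ i, t i : ℝ) : ℂ) ^ (c - 1) *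
        ∏ i, (1 - (t i : ℂ) * x i) ^ (-lam' i)) t := by
    rw [tsum_mul_dirichletKernel_add_nat lam lam' x c hx, Set.indicator_mul_left]
    rfl
  have hF_integral (m) : K * ∫ t, F m t =
      (∏ i, poch (lam i) (m i)) * (∏ i, poch (lam' i) (m i)) /
        (poch μ (∑ i, m i) * ∏ i, (Nat.factorial (m i) : ℂ)) * ∏ i, x i ^ m i := by
    have h1 : Gamma μ ≠ 0 := Gamma_ne_zero_of_re_pos hμ_re
    have h2 : Gamma c ≠ 0 := Gamma_ne_zero_of_re_pos hμ
    have h3 : ∏ i, Gamma (lam i) ≠ 0 :=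
      Finset.prod_ne_zero_iff.2 fun i _ => Gamma_ne_zero_of_re_pos (hlam i)
    simp only [F, coef, integral_const_mul]
    rw [integral_dirichletKernel_add_nat lam c hlam hμ, hμc, Finset.prod_mul_distrib,
      Finset.prod_div_distrib, hK]
    field_simp
  refine ⟨?_, ?_, ?_⟩
  · simp only [← hF_integral, norm_mul]
    refine Summable.mul_left _ ?_
    exact .of_nonneg_of_le (fun m => norm_nonneg _) (fun m => norm_integral_le_integral_norm _)
      hF_sum
  · rw [← integrable_indicator_iff hsimplex]
    refine (hker.norm.const_mul (∑' m, ‖coef m‖)).mono' ?_ (.of_forall fun t => ?_)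
    · refine (Measurable.indicator ?_ hsimplex).aestronglyMeasurable
      fun_prop
    · have hs : Summable fun m => ‖coef m‖ * ‖dirichletKernel 1 lam c t‖ := hcoef.mul_right _
      rw [← htsum, ← tsum_mul_right]
      exact tsum_of_norm_bounded hs.hasSum fun m => hF_le m t
  · simp only [← hF_integral]
    rw [tsum_mul_left, integral_tsum_of_summable_integral_norm hF_int hF_sum,
      ← integral_indicator hsimplex]
    simp only [htsum]
end
end
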